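/- If a circuit containing exactly h Hadamard operations is applied to a standard basis state e_x, and α : (Fin N → Bool) → ℤ is an integer-valued function with ψ(y) = α(y) / (√2)^h for all y (where ψ is the final state), then ∑_{y : Fin N → Bool} α(y)² = 2^h. -/

import Mathlib

/-- A state on `N` qubits: a real amplitude for each basis label. -/
def QState (N : ℕ) := (Fin N → Bool) → ℝ

/-- The Hadamard gate acting on qubit `k`. -/
noncomputable def Hgate {N : ℕ} (k : Fin N) (ψ : QState N) : QState N :=
  fun y => (1 / Real.sqrt 2) *
    (ψ (Function.update y k false) +
      (if y k then (-1 : ℝ) else 1) * ψ (Function.update y k true))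

/-- An operation in a circuit: either a Hadamard gate on some qubit, or a
permutation of the basis labels (modelling Toffoli and other classical
reversible gates). -/
inductive Op (N : ℕ)
  | had (k : Fin N)
  | perm (σ : Equiv.Perm (Fin N → Bool))

/-- The action of an operation on a state. -/
noncomputable def Op.apply {N : ℕ} : Op N → QState N → QState N
  | .had k, ψ => Hgate k ψ
  | .perm σ, ψ => ψ ∘ σ

/-- Run a circuit (a list of operations, applied left to right) on a state. -/
noncomputable def runCircuit {N : ℕ} (C : List (Op N)) (ψ : QState N) : QState N :=
  C.foldl (fun φ op => op.apply φ) ψ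

/-- The number of Hadamard operations in a circuit. -/
def hadCount {N : ℕ} (C : List (Op N)) : ℕ :=
  C.countP (fun op => match op with | .had _ => true | .perm _ => false)

/-- The standard basis state labelled by `x`. -/
def basisState {N : ℕ} (x : Fin N → Bool) : QState N :=
  fun y => if y = x then 1 else 0

/-- Negating one bit of a label, as a permutation of the labels. -/
def flipBit {N : ℕ} (k : Fin N) : Equiv.Perm (Fin N → Bool) :=
  Function.Involutive.toPerm (fun y => Function.update y k (!y k)) (fun y => by simp)

lemma flipBit_apply {N : ℕ} (k : Fin N) (y : Fin N → Bool) :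
    flipBit k y = Function.update y k (!y k) := rfl

lemma Hgate_sq_add_sq {N : ℕ} (k : Fin N) (ψ : QState N) (y : Fin N → Bool) :
    Hgate k ψ y ^ 2 + Hgate k ψ (flipBit k y) ^ 2 = ψ y ^ 2 + ψ (flipBit k y) ^ 2 := by
  have hs : (1 / Real.sqrt 2) ^ 2 = 1 / 2 := by
    rw [div_pow, Real.sq_sqrt zero_le_two, one_pow]
  have hy : Function.update y k (y k) = y := Function.update_eq_self k y
  cases hk : y k <;> rw [hk] at hy <;>
    simp only [Hgate, flipBit_apply, Function.update_idem, Function.update_self, hk, hy,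
      Bool.not_true, Bool.not_false, if_true, if_false, Bool.false_eq_true, mul_pow, hs] <;> ring

lemma sum_Hgate_sq {N : ℕ} (k : Fin N) (ψ : QState N) :
    ∑ y, Hgate k ψ y ^ 2 = ∑ y, ψ y ^ 2 := by
  have hpair := Finset.sum_congr (rfl : (Finset.univ : Finset (Fin N → Bool)) = Finset.univ)
    (fun y _ => Hgate_sq_add_sq k ψ y)
  rw [Finset.sum_add_distrib, Finset.sum_add_distrib,
    Equiv.sum_comp (flipBit k) (fun y => Hgate k ψ y ^ 2),
    Equiv.sum_comp (flipBit k) (fun y => ψ y ^ 2)] at hpair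
  linarith

lemma sum_runCircuit_sq {N : ℕ} (C : List (Op N)) (ψ : QState N) :
    ∑ y, runCircuit C ψ y ^ 2 = ∑ y, ψ y ^ 2 := by
  induction C generalizing ψ with
  | nil => rfl
  | cons op C ih =>
    refine (ih (op.apply ψ)).trans ?_
    cases op with
    | had k => exact sum_Hgate_sq k ψ
    | perm σ => exact Equiv.sum_comp σ (fun y => ψ y ^ 2)

lemma sum_basisState_sq {N : ℕ} (x : Fin N → Bool) : ∑ y, basisState x y ^ 2 = 1 := by
  simp [basisState]

theorem circuit_dyadic_numerators_sum_sq {N : ℕ} (C : List (Op N))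
    (x : Fin N → Bool) (h : ℕ) (hh : hadCount C = h)
    (α : (Fin N → Bool) → ℤ)
    (hα : ∀ y, runCircuit C (basisState x) y = (α y : ℝ) / (Real.sqrt 2) ^ h) :
    ∑ y : Fin N → Bool, (α y) ^ 2 = 2 ^ h := by
  have hnorm := (sum_runCircuit_sq C (basisState x)).trans (sum_basisState_sq x)
  have hs : (Real.sqrt 2 ^ h) ^ 2 = 2 ^ h := by
    rw [← pow_mul, mul_comm, pow_mul, Real.sq_sqrt zero_le_two]
  simp only [hα, div_pow, hs] at hnorm
  rw [← Finset.sum_div, div_eq_one_iff_eq (by positivity)] at hnorm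
  exact_mod_cast hnorm
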